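/- For every k ∈ ℕ, every homogeneous polynomial f ∈ A_k can be written uniquely as f = g + η·h with g ∈ A_k satisfying D(g) = 0 and h ∈ A_{k−3}; that is, A_k = Φ_k ⊕ η·A_{k−3}, where Φ_k = {f ∈ A_k : D(f) = 0}. -/

import Mathlib

open MvPolynomial
open scoped Fin.NatCast

noncomputable section

abbrev A : Type := MvPolynomial (Fin 27) ℂ

/-- the variable `x_i` (1-based indexing). -/
def xv (i : ℕ) : A := X ((i - 1 : ℕ) : Fin 27)

/-- the partial derivative `∂_i` (1-based indexing) as a linear operator. -/
def pdE (i : Fin 27) : Module.End ℂ A := (pderiv i).toLinearMap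

/-- the operator `x_a ∂_b` (1-based indexing). -/
def md (a b : ℕ) : Module.End ℂ A :=
  (LinearMap.mulLeft ℂ (xv a)) ∘ₗ pdE ((b - 1 : ℕ) : Fin 27)

/-- the actions `e_1, …, e_6` of the simple positive root vectors of `E₆`. -/
def eOp : ℕ → Module.End ℂ A
  | 1 => -md 1 2 + md 11 14 + md 15 17 + md 16 19 + md 18 21 + md 20 23
  | 2 => -md 4 6 - md 5 7 - md 8 10 + md 18 20 + md 21 23 + md 22 24
  | 3 => -md 2 3 + md 9 11 + md 12 15 + md 13 16 + md 21 22 + md 23 24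
  | 4 => -md 3 4 - md 7 9 - md 10 12 - md 16 18 - md 19 21 + md 24 25
  | 5 => -md 4 5 - md 6 7 - md 12 13 - md 15 16 - md 17 19 + md 25 26
  | 6 => -md 5 8 - md 7 10 - md 9 12 - md 11 15 - md 14 17 + md 26 27
  | _ => 0

/-- the actions `f_1, …, f_6` of the simple negative root vectors of `E₆`. -/
def fOp : ℕ → Module.End ℂ A
  | 1 => md 2 1 - md 14 11 - md 17 15 - md 19 16 - md 21 18 - md 23 20
  | 2 => md 6 4 + md 7 5 + md 10 8 - md 20 18 - md 23 21 - md 24 22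
  | 3 => md 3 2 - md 11 9 - md 15 12 - md 16 13 - md 22 21 - md 24 23
  | 4 => md 4 3 + md 9 7 + md 12 10 + md 18 16 + md 21 19 - md 25 24
  | 5 => md 5 4 + md 7 6 + md 13 12 + md 16 15 + md 19 17 - md 26 25
  | 6 => md 8 5 + md 10 7 + md 12 9 + md 15 11 + md 17 14 - md 27 26
  | _ => 0

/-- the involution of `{0,…,26}` fixing `12, 13, 14` (0-based version of ι). -/
def iotaF : Fin 27 → Fin 27 := fun j =>
  if j.val = 12 ∨ j.val = 13 ∨ j.val = 14 then j else ⟨26 - j.val, by omega⟩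

/-- the algebra automorphism τ of `A`. -/
def tau : A →ₐ[ℂ] A := rename iotaF

def z1 : A := xv 1 * xv 14 + xv 2 * xv 11 + xv 3 * xv 9 - xv 4 * xv 7 + xv 5 * xv 6
def z2 : A := fOp 6 z1
def z3 : A := fOp 5 z2
def z4 : A := fOp 4 z3
def z5 : A := fOp 3 z4
def z6 : A := fOp 2 z4
def z7 : A := fOp 3 z6
def z8 : A := fOp 1 z5
def z9 : A := fOp 4 z7
def z10 : A := fOp 1 z7
def z11 : A := -(fOp 5 z9)
def z12 : A := fOp 4 z10
def z13 : A := fOp 3 z12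
def z14 : A := -(fOp 6 z11)
def z15 : A := -(fOp 5 z12)

/-- the quadratic polynomials `ζ_1, …, ζ_27` (1-based indexing). -/
def zeta : ℕ → A
  | 1 => z1 | 2 => z2 | 3 => z3 | 4 => z4 | 5 => z5 | 6 => z6 | 7 => z7
  | 8 => z8 | 9 => z9 | 10 => z10 | 11 => z11 | 12 => z12 | 13 => z13
  | 14 => z14 | 15 => z15
  | 16 => tau z12 | 17 => tau z11 | 18 => tau z10 | 19 => tau z9
  | 20 => tau z8 | 21 => tau z7 | 22 => tau z6 | 23 => tau z5
  | 24 => tau z4 | 25 => tau z3 | 26 => tau z2 | 27 => tau z1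
  | _ => 0

/-- the involution ι of `{1,…,27}` fixing `13, 14, 15`. -/
def iotaN (i : ℕ) : ℕ := if i = 13 ∨ i = 14 ∨ i = 15 then i else 28 - i

/-- the signs ε_i. -/
def eps (i : ℕ) : ℂ :=
  if i = 9 ∨ i = 11 ∨ i = 12 ∨ i = 13 ∨ i = 14 ∨ i = 15 ∨ i = 16 ∨ i = 17 ∨ i = 19
  then -1 else 1

/-- the `E₆`-invariant cubic polynomial η (Dickson's trilinear form). -/
def eta : A := ∑ i ∈ Finset.Icc 1 27, eps i • (xv i * zeta (iotaN i))

lemma pderiv_swap (i j : Fin 27) (p : A) :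
    pderiv i (pderiv j p) = pderiv j (pderiv i p) := by
  induction p using MvPolynomial.induction_on with
  | C a => simp
  | add p q hp hq => simp [hp, hq]
  | mul_X p k ih =>
      have h1 : pderiv i ((pderiv j) (X k) : A) = 0 := by
        rcases eq_or_ne j k with h | h
        · subst h; simp [pderiv_X_self]
        · simp [pderiv_X_of_ne (Ne.symm h)]
      have h2 : pderiv j ((pderiv i) (X k) : A) = 0 := by
        rcases eq_or_ne i k with h | h
        · subst h; simp [pderiv_X_self]
        · simp [pderiv_X_of_ne (Ne.symm h)]
      simp only [pderiv_mul, map_add, ih, h1, h2]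
      ring

lemma pdE_comm (i j : Fin 27) : Commute (pdE i) (pdE j) := by
  refine LinearMap.ext fun p => ?_
  simpa [pdE, Module.End.mul_apply] using pderiv_swap i j p

/-- `Im(g)`: the constant-coefficient differential operator obtained from `g` by
replacing each variable `x_i` by `∂_i`. -/
def Imo (g : A) : Module.End ℂ A :=
  ∑ d ∈ g.support, g.coeff d •
    Finset.univ.noncommProd (fun i : Fin 27 => pdE i ^ d i)
      (fun i _ j _ _ => (pdE_comm i j).pow_pow _ _)

/-- the invariant operator `D = Im(η)`. -/
def Dop : Module.End ℂ A := Imo eta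

/-- the Euler operator `D₁`. -/
def D1 : Module.End ℂ A := ∑ i : Fin 27, (LinearMap.mulLeft ℂ (X i : A)) ∘ₗ pdE i

/-- the invariant operator `D₂ = Σ ζ_i · Im(ζ_i)`. -/
def D2 : Module.End ℂ A :=
  ∑ i ∈ Finset.Icc 1 27, (LinearMap.mulLeft ℂ (zeta i)) ∘ₗ Imo (zeta i)


/-- The multifactorial `∏ i, (d i)!`. -/
def multiFactorial (d : Fin 27 →₀ ℕ) : ℕ := ∏ i, (d i).factorial

lemma multiFactorial_add_single (d : Fin 27 →₀ ℕ) (i : Fin 27) :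
    multiFactorial (d + Finsupp.single i 1) = (d i + 1) * multiFactorial d := by
  unfold multiFactorial
  rw [← Finset.mul_prod_erase _ _ (Finset.mem_univ i),
    ← Finset.mul_prod_erase _ (fun j => (d j).factorial) (Finset.mem_univ i)]
  have h : ∀ j ∈ Finset.univ.erase i,
      ((d + Finsupp.single i 1 : Fin 27 →₀ ℕ) j).factorial = (d j).factorial := by
    intro j hj
    simp [Finsupp.single_eq_of_ne (Finset.ne_of_mem_erase hj)]
  rw [Finset.prod_congr rfl h]
  simp [Nat.factorial_succ, mul_assoc]

/-- The bilinear Fischer pairing, `⟨x^d, x^e⟩ = d! δ_{d,e}`. -/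
def fischer (q : A) : A →ₗ[ℂ] ℂ :=
  (basisMonomials (Fin 27) ℂ).constr ℂ fun d => (multiFactorial d : ℂ) * coeff d q

lemma fischer_monomial (q : A) (d : Fin 27 →₀ ℕ) (c : ℂ) :
    fischer q (monomial d c) = c * ((multiFactorial d : ℂ) * coeff d q) := by
  have h : (monomial d c : A) = c • basisMonomials (Fin 27) ℂ d := by
    simp [smul_monomial]
  rw [h, map_smul, fischer, Module.Basis.constr_basis, smul_eq_mul]

lemma fischer_eq_sum (p q : A) :
    fischer q p = ∑ d ∈ p.support, coeff d p * ((multiFactorial d : ℂ) * coeff d q) := by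
  conv_lhs => rw [← support_sum_monomial_coeff p]
  rw [map_sum]
  exact Finset.sum_congr rfl fun d _ => fischer_monomial q d _

lemma fischer_X_mul (i : Fin 27) (p q : A) :
    fischer q (X i * p) = fischer (pdE i q) p := by
  induction p using MvPolynomial.induction_on' with
  | monomial d c =>
    rw [mul_comm, X, monomial_mul, mul_one, fischer_monomial, fischer_monomial,
      multiFactorial_add_single]
    simp only [pdE, Derivation.coeFn_coe, coeff_pderiv]
    push_cast
    ring
  | add p q hp hq => rw [mul_add, map_add, map_add, hp, hq]

lemma fischer_X_pow_mul (i : Fin 27) (n : ℕ) (p q : A) :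
    fischer q (X i ^ n * p) = fischer ((pdE i ^ n) q) p := by
  induction n generalizing p q with
  | zero => simp
  | succ n ih => rw [pow_succ', mul_assoc, fischer_X_mul, ih, pow_succ, Module.End.mul_apply]

lemma fischer_prod_X_pow_mul (d : Fin 27 →₀ ℕ) (s : Finset (Fin 27))
    (comm : (s : Set (Fin 27)).Pairwise (Function.onFun Commute fun i => pdE i ^ d i))
    (p q : A) :
    fischer q ((∏ i ∈ s, X i ^ d i) * p) =
      fischer (s.noncommProd (fun i => pdE i ^ d i) comm q) p := by
  induction s using Finset.induction_on generalizing p q with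
  | empty => rw [Finset.prod_empty, one_mul, Finset.noncommProd_empty, Module.End.one_apply]
  | insert i s hi ih =>
    rw [Finset.prod_insert hi, Finset.noncommProd_insert_of_notMem' _ _ _ _ hi, mul_assoc,
      fischer_X_pow_mul, ih, Module.End.mul_apply]

lemma fischer_add_right (p q r : A) : fischer (q + r) p = fischer q p + fischer r p := by
  simp only [fischer_eq_sum, coeff_add, mul_add, Finset.sum_add_distrib]

lemma fischer_smul_right (c : ℂ) (p q : A) : fischer (c • q) p = c * fischer q p := by
  simp only [fischer_eq_sum, coeff_smul, smul_eq_mul, Finset.mul_sum]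
  exact Finset.sum_congr rfl fun _ _ => by ring

/-- The Fischer pairing as a linear map in its second argument. -/
def fischerRight (p : A) : A →ₗ[ℂ] ℂ where
  toFun q := fischer q p
  map_add' q r := fischer_add_right p q r
  map_smul' c q := fischer_smul_right c p q

lemma fischer_monomial_mul (d : Fin 27 →₀ ℕ) (c : ℂ) (p q : A) :
    fischer q (monomial d c * p) =
      c * fischer (Finset.univ.noncommProd (fun i : Fin 27 => pdE i ^ d i)
        (fun i _ j _ _ => (pdE_comm i j).pow_pow _ _) q) p := by
  rw [monomial_eq, Finsupp.prod_fintype _ _ (fun _ => pow_zero _), mul_assoc, ← smul_eq_C_mul,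
    map_smul, smul_eq_mul,
    fischer_prod_X_pow_mul d _ (fun i _ j _ _ => (pdE_comm i j).pow_pow _ _)]

/-- Multiplication by `r` and `Im(r)` are adjoint for the Fischer pairing. -/
lemma fischer_mul (r p q : A) : fischer q (r * p) = fischer (Imo r q) p := by
  have hright : ∀ s : A, fischer s p = fischerRight p s := fun _ => rfl
  conv_lhs => rw [← support_sum_monomial_coeff r]
  rw [Finset.sum_mul, map_sum, hright, Imo, LinearMap.sum_apply, map_sum]
  refine Finset.sum_congr rfl fun d _ => ?_
  rw [LinearMap.smul_apply, map_smul, fischer_monomial_mul, ← hright, smul_eq_mul]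

lemma eq_zero_of_fischer_star_eq_zero {p : A}
    (h : fischer p (map (starRingEnd ℂ) p) = 0) : p = 0 := by
  have hs : (map (starRingEnd ℂ) p).support = p.support :=
    support_map_of_injective _ (starRingEnd ℂ).injective
  rw [fischer_eq_sum, hs] at h
  have hterm : ∀ d, coeff d (map (starRingEnd ℂ) p) * ((multiFactorial d : ℂ) * coeff d p) =
      ((multiFactorial d * Complex.normSq (coeff d p) : ℝ) : ℂ) := by
    intro d
    rw [coeff_map]
    push_cast
    rw [Complex.normSq_eq_conj_mul_self]
    ring
  rw [Finset.sum_congr rfl fun d _ => hterm d, ← Complex.ofReal_sum, Complex.ofReal_eq_zero,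
    Finset.sum_eq_zero_iff_of_nonneg fun d _ =>
      mul_nonneg (Nat.cast_nonneg _) (Complex.normSq_nonneg _)] at h
  ext d
  by_contra hd
  have hd' : coeff d p ≠ 0 := by simpa using hd
  have hf : (multiFactorial d : ℝ) ≠ 0 :=
    Nat.cast_ne_zero.mpr (Finset.prod_ne_zero_iff.mpr fun i _ => Nat.factorial_ne_zero _)
  exact mul_ne_zero hf (Complex.normSq_pos.mpr hd').ne' (h d (mem_support_iff.mpr hd'))

lemma fischer_eq_zero_of_ne {m n : ℕ} {p q : A} (hp : p.IsHomogeneous m)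
    (hq : q.IsHomogeneous n) (h : m ≠ n) : fischer q p = 0 := by
  rw [fischer_eq_sum]
  refine Finset.sum_eq_zero fun d hd => ?_
  have hdm : d.degree = m := by
    by_contra hne
    exact mem_support_iff.mp hd (hp.coeff_eq_zero hne)
  rw [hq.coeff_eq_zero (hdm ▸ h), mul_zero, mul_zero]

/-- The quadratic forms with real coefficients. -/
def realQuadratic : AddSubgroup A where
  carrier := {p | p.IsHomogeneous 2 ∧ map (starRingEnd ℂ) p = p}
  zero_mem' := ⟨isHomogeneous_zero _ _ _, map_zero _⟩
  add_mem' ha hb := ⟨ha.1.add hb.1, by rw [map_add, ha.2, hb.2]⟩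
  neg_mem' ha := ⟨ha.1.neg, by rw [map_neg, ha.2]⟩

lemma xv_mul_xv_mem (a b : ℕ) : xv a * xv b ∈ realQuadratic :=
  ⟨(isHomogeneous_X _ _).mul (isHomogeneous_X _ _), by simp [xv]⟩

lemma md_mem {p : A} (hp : p ∈ realQuadratic) (a b : ℕ) : md a b p ∈ realQuadratic := by
  refine ⟨(isHomogeneous_X _ _).mul (n := 1) hp.1.pderiv, ?_⟩
  simp only [md, pdE, xv, LinearMap.comp_apply, LinearMap.mulLeft_apply,
    Derivation.coeFn_coe, map_mul, map_X]
  rw [← pderiv_map, hp.2]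

lemma fOp_mem {p : A} (hp : p ∈ realQuadratic) (i : ℕ) : fOp i p ∈ realQuadratic := by
  unfold fOp
  split <;> simp only [LinearMap.add_apply, LinearMap.sub_apply, LinearMap.zero_apply] <;>
    repeat' first
      | with_reducible exact md_mem hp _ _
      | with_reducible apply add_mem
      | with_reducible apply sub_mem
      | with_reducible exact zero_mem _

lemma tau_mem {p : A} (hp : p ∈ realQuadratic) : tau p ∈ realQuadratic :=
  ⟨hp.1.rename_isHomogeneous, by rw [tau, map_rename, hp.2]⟩

lemma zeta_mem (i : ℕ) : zeta i ∈ realQuadratic := by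
  have h1 : z1 ∈ realQuadratic := by
    unfold z1
    repeat' first
      | with_reducible exact xv_mul_xv_mem _ _
      | with_reducible apply add_mem
      | with_reducible apply sub_mem
  have h2 : z2 ∈ realQuadratic := fOp_mem h1 _
  have h3 : z3 ∈ realQuadratic := fOp_mem h2 _
  have h4 : z4 ∈ realQuadratic := fOp_mem h3 _
  have h5 : z5 ∈ realQuadratic := fOp_mem h4 _
  have h6 : z6 ∈ realQuadratic := fOp_mem h4 _
  have h7 : z7 ∈ realQuadratic := fOp_mem h6 _
  have h8 : z8 ∈ realQuadratic := fOp_mem h5 _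
  have h9 : z9 ∈ realQuadratic := fOp_mem h7 _
  have h10 : z10 ∈ realQuadratic := fOp_mem h7 _
  have h11 : z11 ∈ realQuadratic := neg_mem (fOp_mem h9 _)
  have h12 : z12 ∈ realQuadratic := fOp_mem h10 _
  have h13 : z13 ∈ realQuadratic := fOp_mem h12 _
  have h14 : z14 ∈ realQuadratic := neg_mem (fOp_mem h11 _)
  have h15 : z15 ∈ realQuadratic := neg_mem (fOp_mem h12 _)
  unfold zeta
  split <;> first
    | with_reducible assumption
    | (with_reducible apply tau_mem); with_reducible assumption
    | exact zero_mem _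

lemma eta_isHomogeneous : eta.IsHomogeneous 3 :=
  IsHomogeneous.sum _ _ _ fun i _ => by
    rw [smul_eq_C_mul]
    exact ((isHomogeneous_X _ _).mul (zeta_mem _).1).C_mul _

lemma map_star_eta : map (starRingEnd ℂ) eta = eta := by
  rw [eta, map_sum]
  refine Finset.sum_congr rfl fun i _ => ?_
  rw [smul_eq_C_mul, map_mul, map_mul, map_C, (zeta_mem _).2, xv, map_X]
  congr 2
  unfold eps
  split <;> simp

lemma fOp_mul (i : ℕ) (p q : A) : fOp i (p * q) = fOp i p * q + p * fOp i q := by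
  unfold fOp
  split <;>
    simp only [md, pdE, LinearMap.add_apply, LinearMap.sub_apply, LinearMap.comp_apply,
      LinearMap.mulLeft_apply, LinearMap.zero_apply, Derivation.coeFn_coe,
      pderiv_mul] <;> ring

lemma md_xv (a b c : ℕ) :
    md a b (xv c) = if ((b - 1 : ℕ) : Fin 27) = ((c - 1 : ℕ) : Fin 27) then xv a else 0 := by
  simp only [md, pdE, LinearMap.comp_apply, LinearMap.mulLeft_apply,
    Derivation.coeFn_coe]
  rw [xv, xv, pderiv_X]
  by_cases h : ((b - 1 : ℕ) : Fin 27) = ((c - 1 : ℕ) : Fin 27)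
  · simp [h]
  · rw [Pi.single_eq_of_ne (Ne.symm h), mul_zero, if_neg h]

lemma z14_eq : z14 = -(xv 1 * xv 27) - xv 8 * xv 20 - xv 10 * xv 18 + xv 12 * xv 16
    - xv 13 * xv 15 := by
  have h2 : z2 = xv 1 * xv 17 + xv 2 * xv 15 + xv 3 * xv 12 - xv 4 * xv 10 + xv 8 * xv 6 := by
    simp [z2, z1, fOp_mul]
    simp [fOp, md_xv]
  have h3 : z3 = xv 1 * xv 19 + xv 2 * xv 16 + xv 3 * xv 13 - xv 5 * xv 10 + xv 8 * xv 7 := by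
    simp [z3, h2, fOp_mul]
    simp [fOp, md_xv]
  have h4 : z4 = xv 1 * xv 21 + xv 2 * xv 18 + xv 4 * xv 13 - xv 5 * xv 12 + xv 8 * xv 9 := by
    simp [z4, h3, fOp_mul]
    simp [fOp, md_xv]
  have h6 : z6 = -(xv 1 * xv 23) - xv 2 * xv 20 + xv 6 * xv 13 - xv 7 * xv 12
      + xv 10 * xv 9 := by
    simp [z6, h4, fOp_mul]
    simp [fOp, md_xv]
    ring
  have h7 : z7 = xv 1 * xv 24 - xv 3 * xv 20 - xv 6 * xv 16 + xv 7 * xv 15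
      - xv 10 * xv 11 := by
    simp [z7, h6, fOp_mul]
    simp [fOp, md_xv]
    ring
  have h9 : z9 = -(xv 1 * xv 25) - xv 4 * xv 20 - xv 6 * xv 18 + xv 9 * xv 15
      - xv 12 * xv 11 := by
    simp [z9, h7, fOp_mul]
    simp [fOp, md_xv]
  have h11 : z11 = -(xv 1 * xv 26) + xv 5 * xv 20 + xv 7 * xv 18 - xv 9 * xv 16
      + xv 13 * xv 11 := by
    simp [z11, h9, fOp_mul]
    simp [fOp, md_xv]
    ring
  simp [z14, h11, fOp_mul]
  simp [fOp, md_xv]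
  ring

lemma eta_ne_zero : eta ≠ 0 := by
  intro h
  let P : Fin 27 → ℂ := fun j => if j = 0 ∨ j = 13 ∨ j = 26 then 1 else 0
  have hP : ∀ i, eval P (xv i) = if ((i - 1 : ℕ) : Fin 27) = 0 ∨ ((i - 1 : ℕ) : Fin 27) = 13 ∨
      ((i - 1 : ℕ) : Fin 27) = 26 then 1 else 0 := fun i => eval_X _
  have h0 := congrArg (eval P) h
  rw [eta, map_sum, map_zero] at h0
  have hsub : ({1, 14, 27} : Finset ℕ) ⊆ Finset.Icc 1 27 := by decide
  have hout : ∀ i ∈ Finset.Icc 1 27, i ∉ ({1, 14, 27} : Finset ℕ) →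
      ¬ (((i - 1 : ℕ) : Fin 27) = 0 ∨ ((i - 1 : ℕ) : Fin 27) = 13 ∨
        ((i - 1 : ℕ) : Fin 27) = 26) := by decide
  rw [← Finset.sum_subset hsub fun i hi hi' => by
    rw [smul_eval, map_mul, hP, if_neg (hout i hi hi'), zero_mul, mul_zero]] at h0
  have hz1 : eval P z1 = 1 := by simp [z1, hP]
  have hz14 : eval P z14 = -1 := by simp [z14_eq, hP]
  have hPi : P ∘ iotaF = P := by
    have hi : ∀ j : Fin 27, (iotaF j = 0 ∨ iotaF j = 13 ∨ iotaF j = 26) ↔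
        (j = 0 ∨ j = 13 ∨ j = 26) := by decide
    funext j
    exact if_congr (hi j) rfl rfl
  have hz27 : eval P (tau z1) = 1 := by rw [tau, eval_rename, hPi, hz1]
  simp [hP, iotaN, zeta, eps, hz1, hz14, hz27] at h0
  norm_num at h0

lemma eq_zero_of_Dop_eta_mul_eq_zero {h : A} (hh : Dop (eta * h) = 0) : h = 0 := by
  have h0 : eta * h = 0 := by
    apply eq_zero_of_fischer_star_eq_zero
    rw [map_mul, map_star_eta, fischer_mul]
    change fischer (Dop (eta * h)) _ = 0
    rw [hh, fischer_eq_sum]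
    exact Finset.sum_eq_zero fun d _ => by rw [coeff_zero, mul_zero, mul_zero]
  exact (mul_eq_zero.mp h0).resolve_left eta_ne_zero

lemma coeff_Dop_eq_zero {k : ℕ} {f : A} (hf : f.IsHomogeneous k) {d : Fin 27 →₀ ℕ}
    (hd : 3 + d.degree ≠ k) : coeff d (Dop f) = 0 := by
  have h : fischer (Dop f) (monomial d 1) = 0 := by
    rw [Dop, ← fischer_mul]
    exact fischer_eq_zero_of_ne
      (eta_isHomogeneous.mul (isHomogeneous_monomial _ rfl)) hf hd
  rw [fischer_monomial, one_mul] at h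
  exact (mul_eq_zero.mp h).resolve_left
    (Nat.cast_ne_zero.mpr (Finset.prod_ne_zero_iff.mpr fun i _ => Nat.factorial_ne_zero _))

lemma isHomogeneous_Dop {n k : ℕ} (hk : 3 + n = k) {f : A} (hf : f.IsHomogeneous k) :
    (Dop f).IsHomogeneous n := by
  intro d hd
  have hdeg : Finsupp.weight 1 d = d.degree :=
    (DFunLike.congr_fun (Finsupp.degree_eq_weight_one (R := ℕ)) d).symm
  by_contra hne
  exact hd (coeff_Dop_eq_zero hf (by omega))

lemma exists_Dop_eta_mul_eq {n : ℕ} {q : A} (hq : q ∈ homogeneousSubmodule (Fin 27) ℂ n) :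
    ∃ h ∈ homogeneousSubmodule (Fin 27) ℂ n, Dop (eta * h) = q := by
  have hmaps : ∀ h ∈ homogeneousSubmodule (Fin 27) ℂ n,
      (Dop ∘ₗ LinearMap.mulLeft ℂ eta) h ∈ homogeneousSubmodule (Fin 27) ℂ n := by
    exact fun h hh => isHomogeneous_Dop rfl (eta_isHomogeneous.mul hh)
  have : Module.Finite ℂ (homogeneousSubmodule (Fin 27) ℂ n) :=
    Module.Finite.iff_fg.mpr (homogeneousSubmodule_fg _ _ n)
  have hinj : Function.Injective ((Dop ∘ₗ LinearMap.mulLeft ℂ eta).restrict hmaps) := by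
    rw [injective_iff_map_eq_zero]
    intro h hh
    exact Subtype.ext (eq_zero_of_Dop_eta_mul_eq_zero (congrArg Subtype.val hh))
  obtain ⟨h, hh⟩ := LinearMap.surjective_of_injective hinj ⟨q, hq⟩
  exact ⟨h, h.2, congrArg Subtype.val hh⟩

/-- `A_k = Φ_k ⊕ η · A_{k-3}`. -/
theorem stmt15 (k : ℕ) (f : A) (hf : f ∈ homogeneousSubmodule (Fin 27) ℂ k) :
    ∃! p : A × A,
      p.1 ∈ homogeneousSubmodule (Fin 27) ℂ k ∧ Dop p.1 = 0 ∧
      p.2 ∈ (if 3 ≤ k then homogeneousSubmodule (Fin 27) ℂ (k - 3)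
             else (⊥ : Submodule ℂ A)) ∧
      f = p.1 + eta * p.2 := by
  have hex : ∃ h ∈ (if 3 ≤ k then homogeneousSubmodule (Fin 27) ℂ (k - 3)
      else (⊥ : Submodule ℂ A)), Dop (eta * h) = Dop f := by
    split_ifs with hk
    · apply exists_Dop_eta_mul_eq
      exact isHomogeneous_Dop (Nat.add_sub_cancel' hk) hf
    · refine ⟨0, zero_mem _, ?_⟩
      rw [mul_zero, map_zero]
      ext d
      rw [coeff_zero, coeff_Dop_eq_zero hf (by omega)]
  obtain ⟨h, hmem, hD⟩ := hex
  refine ⟨(f - eta * h, h), ⟨sub_mem hf ?_, ?_, hmem, ?_⟩, ?_⟩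
  · split_ifs at hmem with hk
    · have := eta_isHomogeneous.mul hmem
      rwa [Nat.add_sub_cancel' hk] at this
    · rw [(Submodule.mem_bot ℂ).mp hmem, mul_zero]
      exact zero_mem _
  · rw [map_sub, hD, sub_self]
  · rw [sub_add_cancel]
  · rintro ⟨g', h'⟩ ⟨-, hg', -, hf'⟩
    have hh : h' - h = 0 := by
      apply eq_zero_of_Dop_eta_mul_eq_zero
      rw [mul_sub, map_sub, hD, hf', map_add, hg', zero_add, sub_self]
    have hh' : h' = h := sub_eq_zero.mp hh
    subst hh'
    simp only [Prod.mk.injEq, and_true]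
    exact eq_sub_of_add_eq hf'.symm

end
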